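/- Let d ≥ 2 be an integer, let F=(F₁,F₂,F₃) be a triple of complete flags in ℂ^d in general position, and let u ∈ SL_d(ℂ) be a unipotent linear map with u·F₂ = F₂ and u·F₁ = F₃. Let (f₁,…,f_d) and (f₁',…,f_d') be bases of ℂ^d adapted to (F₂,F₃,F₁) and to (F₃,F₁,F₂) respectively, with f₁ = f_d'. Then for every m∈{1,…,d}, u(f_m) = (−1)^{m−1}·(∏_{j∈ℬ : j₂ ≤ m−1} T^j(F₁,F₂,F₃))·f_{d−m+1}'. -/

import Mathlib

open scoped BigOperators

/-- A complete flag in `ℂ^d`, recorded by its chain of subspaces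
`{0} = F^0 ⊆ F^1 ⊆ ⋯ ⊆ F^d = ℂ^d` with `dim F^k = k` (the values for `k > d` are `⊤`). -/
structure CompleteFlag (d : ℕ) where
  space : ℕ → Submodule ℂ (Fin d → ℂ)
  mono : Monotone space
  finrank_eq : ∀ k, k ≤ d → Module.finrank ℂ (space k) = k
  eq_top : ∀ k, d ≤ k → space k = ⊤

/-- A tuple of complete flags is in general position if
`F₁^{k₁} + ⋯ + F_m^{k_m} = ℂ^d` whenever `k₁ + ⋯ + k_m = d`. -/
def GenPos {d m : ℕ} (F : Fin m → CompleteFlag d) : Prop :=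
  ∀ k : Fin m → ℕ, (∑ i, k i) = d → (⨆ i, (F i).space (k i)) = ⊤

/-- The exterior algebra of `ℂ^d`. -/
abbrev ExtAlg (d : ℕ) := ExteriorAlgebra ℂ (Fin d → ℂ)

/-- The image of `⋀^k (F^k)` inside the exterior algebra of `ℂ^d`. -/
noncomputable def flagPower {d : ℕ} (F : CompleteFlag d) (k : ℕ) : Submodule ℂ (ExtAlg d) :=
  (Submodule.map (ExteriorAlgebra.ι ℂ) (F.space k)) ^ k

/-- The top exterior power `⋀^d (ℂ^d)` inside the exterior algebra. -/
noncomputable def topPower (d : ℕ) : Submodule ℂ (ExtAlg d) :=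
  (LinearMap.range (ExteriorAlgebra.ι ℂ : (Fin d → ℂ) →ₗ[ℂ] ExtAlg d)) ^ d

/-- A linear functional realizing a fixed isomorphism `⋀^d (ℂ^d) ≅ ℂ`,
i.e. injective on the top exterior power. -/
def IsTopIso {d : ℕ} (φ : ExtAlg d →ₗ[ℂ] ℂ) : Prop :=
  ∀ x ∈ topPower d, φ x = 0 → x = 0

/-- A choice, for each `k ≤ d`, of a nonzero element `f^k ∈ ⋀^k (F^k)`. -/
def IsFlagChoice {d : ℕ} (F : CompleteFlag d) (f : ℕ → ExtAlg d) : Prop :=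
  ∀ k, k ≤ d → f k ∈ flagPower F k ∧ f k ≠ 0

/-- A canonical choice of a nonzero element of `⋀^k (F^k)`. -/
noncomputable def flagElt {d : ℕ} (F : CompleteFlag d) (k : ℕ) : ExtAlg d :=
  open scoped Classical in
  if h : ∃ x, x ∈ flagPower F k ∧ x ≠ 0 then h.choose else 0

/-- The triple ratio computed from given choices `f₁, f₂, f₃` of elements. -/
noncomputable def tripleRatioOf {d : ℕ} (φ : ExtAlg d →ₗ[ℂ] ℂ) (f₁ f₂ f₃ : ℕ → ExtAlg d)
    (j : ℕ × ℕ × ℕ) : ℂ :=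
  (φ (f₁ (j.1 + 1) * f₂ j.2.1 * f₃ (j.2.2 - 1)) *
   φ (f₁ j.1 * f₂ (j.2.1 - 1) * f₃ (j.2.2 + 1)) *
   φ (f₁ (j.1 - 1) * f₂ (j.2.1 + 1) * f₃ j.2.2)) /
  (φ (f₁ (j.1 - 1) * f₂ j.2.1 * f₃ (j.2.2 + 1)) *
   φ (f₁ j.1 * f₂ (j.2.1 + 1) * f₃ (j.2.2 - 1)) *
   φ (f₁ (j.1 + 1) * f₂ (j.2.1 - 1) * f₃ j.2.2))

/-- The `j`-triple ratio `T^j(F₁,F₂,F₃)`. -/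
noncomputable def tripleRatio {d : ℕ} (φ : ExtAlg d →ₗ[ℂ] ℂ) (F₁ F₂ F₃ : CompleteFlag d)
    (j : ℕ × ℕ × ℕ) : ℂ :=
  tripleRatioOf φ (flagElt F₁) (flagElt F₂) (flagElt F₃) j

/-- The double ratio computed from given choices of elements. -/
noncomputable def doubleRatioOf {d : ℕ} (φ : ExtAlg d →ₗ[ℂ] ℂ) (g₁ g₂ h₁ h₂ : ℕ → ExtAlg d)
    (i : ℕ × ℕ) : ℂ :=
  -((φ (g₁ i.1 * g₂ (i.2 - 1) * h₁ 1) * φ (g₁ (i.1 - 1) * g₂ i.2 * h₂ 1)) /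
    (φ (g₁ i.1 * g₂ (i.2 - 1) * h₂ 1) * φ (g₁ (i.1 - 1) * g₂ i.2 * h₁ 1)))

/-- The `i`-double ratio `D^i(G₁,G₂,H₁,H₂)`. -/
noncomputable def doubleRatio {d : ℕ} (φ : ExtAlg d →ₗ[ℂ] ℂ) (G₁ G₂ H₁ H₂ : CompleteFlag d)
    (i : ℕ × ℕ) : ℂ :=
  doubleRatioOf φ (flagElt G₁) (flagElt G₂) (flagElt H₁) (flagElt H₂) i

/-- `𝒜`: pairs of positive integers summing to `d`. -/
def Aset (d : ℕ) : Finset (ℕ × ℕ) :=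
  (Finset.range (d + 1) ×ˢ Finset.range (d + 1)).filter
    fun i => 0 < i.1 ∧ 0 < i.2 ∧ i.1 + i.2 = d

/-- `ℬ`: triples of positive integers summing to `d`. -/
def Bset (d : ℕ) : Finset (ℕ × ℕ × ℕ) :=
  (Finset.range (d + 1) ×ˢ Finset.range (d + 1) ×ˢ Finset.range (d + 1)).filter
    fun j => 0 < j.1 ∧ 0 < j.2.1 ∧ 0 < j.2.2 ∧ j.1 + j.2.1 + j.2.2 = d


/-- `v 1, …, v d` is a basis of `ℂ^d` (values of `v` outside `{1, …, d}` are irrelevant). -/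
def IsBasisFam (d : ℕ) (v : ℕ → (Fin d → ℂ)) : Prop :=
  LinearIndependent ℂ (fun i : Fin d => v ((i : ℕ) + 1)) ∧
    Submodule.span ℂ (v '' Set.Icc 1 d) = ⊤

/-- The basis `v 1, …, v d` of `ℂ^d` is adapted to the triple of flags `(F₁, F₂, F₃)`:
`v m ∈ F₁^m ∩ F₃^{d-m+1}` for `1 ≤ m ≤ d` and `v 1 + ⋯ + v d ∈ F₂^1`. -/
def AdaptedBasis {d : ℕ} (F₁ F₂ F₃ : CompleteFlag d) (v : ℕ → (Fin d → ℂ)) : Prop :=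
  IsBasisFam d v ∧
    (∀ m, 1 ≤ m → m ≤ d → v m ∈ F₁.space m ⊓ F₃.space (d - m + 1)) ∧
    (∑ m ∈ Finset.Icc 1 d, v m) ∈ F₂.space 1


section ExteriorPowers

open Module

variable {K V : Type*} [Field K] [AddCommGroup V] [Module K V]

lemma ιMulti_ne_zero_of_linearIndependent {n : ℕ} {a : Fin n → V} (ha : LinearIndependent K a) :
    ExteriorAlgebra.ιMulti K n a ≠ 0 := by
  have h := (exteriorPower.ιMulti_family_linearIndependent_field (n := n) ha).ne_zero
    (Set.powersetCard.ofFinEmbEquiv (RelEmbedding.refl _))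
  intro h0
  apply h
  ext
  simp only [exteriorPower.ιMulti_family, Equiv.symm_apply_apply]
  exact h0

lemma ι_mul_eq_neg_one_pow_smul {n : ℕ} {x : ExteriorAlgebra K V}
    (hx : x ∈ (LinearMap.range (ExteriorAlgebra.ι K : V →ₗ[K] ExteriorAlgebra K V)) ^ n) (v : V) :
    ExteriorAlgebra.ι K v * x = (-1 : K) ^ n • (x * ExteriorAlgebra.ι K v) := by
  induction hx using Submodule.pow_induction_on_left' with
  | algebraMap r => simp [Algebra.commutes]
  | add x y i _ _ hx hy => rw [mul_add, add_mul, smul_add, hx, hy]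
  | mem_mul m hm i x _ ih =>
    obtain ⟨w, rfl⟩ := hm
    rw [← mul_assoc, eq_neg_of_add_eq_zero_left (ExteriorAlgebra.ι_add_mul_swap v w), neg_mul,
      mul_assoc, ih, mul_smul_comm, mul_assoc, pow_succ, mul_neg_one, neg_smul]

lemma map_ι_pow_le_range_pow (P : Submodule K V) (n : ℕ) :
    (P.map (ExteriorAlgebra.ι K)) ^ n ≤
      (LinearMap.range (ExteriorAlgebra.ι K : V →ₗ[K] ExteriorAlgebra K V)) ^ n :=
  pow_le_pow_left' LinearMap.map_le_range n

variable [FiniteDimensional K V]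

/-- The `n`-th exterior power of a subspace, as a power inside the exterior algebra, has
dimension `(dim P).choose n`. -/
lemma finrank_map_ι_pow (P : Submodule K V) (n : ℕ) :
    finrank K ((P.map (ExteriorAlgebra.ι K)) ^ n : Submodule K (ExteriorAlgebra K V)) =
      (finrank K P).choose n := by
  have h : (P.map (ExteriorAlgebra.ι K)) ^ n =
      (⋀[K]^n P).map (ExteriorAlgebra.map P.subtype).toLinearMap := by
    rw [ExteriorAlgebra.exteriorPower, Submodule.map_pow, ← LinearMap.range_comp,
      ExteriorAlgebra.map_comp_ι, LinearMap.range_comp, Submodule.range_subtype]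
  have hinj : Function.Injective (ExteriorAlgebra.map P.subtype).toLinearMap :=
    ExteriorAlgebra.map_injective_field P.ker_subtype
  rw [h, (Submodule.equivMapOfInjective _ hinj _).finrank_eq.symm, exteriorPower.finrank_eq]

lemma finiteDimensional_map_ι_pow (P : Submodule K V) (n : ℕ) :
    FiniteDimensional K ((P.map (ExteriorAlgebra.ι K)) ^ n : Submodule K (ExteriorAlgebra K V)) := by
  refine Module.Finite.iff_fg.2 (Submodule.FG.pow (Submodule.FG.map _ ?_) n)
  exact IsNoetherian.noetherian P

lemma exists_eq_smul_of_mem_map_ι_pow {P : Submodule K V} {n : ℕ} (hP : finrank K P = n)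
    {x y : ExteriorAlgebra K V} (hx : x ∈ (P.map (ExteriorAlgebra.ι K)) ^ n) (hx0 : x ≠ 0)
    (hy : y ∈ (P.map (ExteriorAlgebra.ι K)) ^ n) : ∃ r : K, y = r • x := by
  have h := finrank_map_ι_pow P n
  rw [hP, Nat.choose_self, finrank_eq_one_iff_of_nonzero' ⟨x, hx⟩ (by simpa using hx0)] at h
  obtain ⟨r, hr⟩ := h ⟨y, hy⟩
  exact ⟨r, by simpa using (congrArg Subtype.val hr).symm⟩

lemma mul_ι_eq_zero_of_mem {P : Submodule K V} {n : ℕ} (hP : finrank K P = n)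
    {x : ExteriorAlgebra K V} (hx : x ∈ (P.map (ExteriorAlgebra.ι K)) ^ n)
    {v : V} (hv : v ∈ P) : x * ExteriorAlgebra.ι K v = 0 := by
  have h := finrank_map_ι_pow P (n + 1)
  have := finiteDimensional_map_ι_pow P (n + 1)
  rw [hP, Nat.choose_succ_self, Submodule.finrank_eq_zero] at h
  rw [← Submodule.mem_bot K, ← h, pow_succ]
  exact Submodule.mul_mem_mul hx (Submodule.mem_map_of_mem hv)

lemma exists_basis_eq_smul_ιMulti {P : Submodule K V} {n : ℕ} (hP : finrank K P = n)
    {x : ExteriorAlgebra K V} (hx : x ∈ (P.map (ExteriorAlgebra.ι K)) ^ n) :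
    ∃ (a : Basis (Fin n) K P) (r : K),
      x = r • ExteriorAlgebra.ιMulti K n (fun i => (a i : V)) := by
  have a := finBasisOfFinrankEq K P hP
  have hli : LinearIndependent K (fun i => (a i : V)) :=
    a.linearIndependent.map' P.subtype P.ker_subtype
  refine ⟨a, exists_eq_smul_of_mem_map_ι_pow hP ?_ (ιMulti_ne_zero_of_linearIndependent hli) hx⟩
  rw [ExteriorAlgebra.ιMulti_apply]
  clear * -
  have : ∀ (m : ℕ) (g : Fin m → P), (List.ofFn fun i => ExteriorAlgebra.ι K (g i : V)).prod ∈
      (P.map (ExteriorAlgebra.ι K)) ^ m := by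
    intro m
    induction m with
    | zero => simp [Submodule.one_le.1]
    | succ m ih =>
      intro g
      rw [List.ofFn_succ, List.prod_cons, pow_succ']
      exact Submodule.mul_mem_mul (Submodule.mem_map_of_mem (g 0).2) (ih fun i => g i.succ)
  exact this n a

/-- Nonzero top exterior powers of independent subspaces have nonzero product. -/
lemma mul_ne_zero_of_disjoint {P Q : Submodule K V} (hPQ : Disjoint P Q) {m n : ℕ}
    (hP : finrank K P = m) (hQ : finrank K Q = n) {x y : ExteriorAlgebra K V}
    (hx : x ∈ (P.map (ExteriorAlgebra.ι K)) ^ m) (hx0 : x ≠ 0)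
    (hy : y ∈ (Q.map (ExteriorAlgebra.ι K)) ^ n) (hy0 : y ≠ 0) : x * y ≠ 0 := by
  obtain ⟨a, r, rfl⟩ := exists_basis_eq_smul_ιMulti hP hx
  obtain ⟨b, s, rfl⟩ := exists_basis_eq_smul_ιMulti hQ hy
  have hr : r ≠ 0 := by rintro rfl; simp at hx0
  have hs : s ≠ 0 := by rintro rfl; simp at hy0
  rw [smul_mul_smul_comm, ExteriorAlgebra.ιMulti_mul_ιMulti]
  refine smul_ne_zero (mul_ne_zero hr hs) (ιMulti_ne_zero_of_linearIndependent ?_)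
  rw [← linearIndependent_equiv finSumFinEquiv, ← Sum.elim_comp_inl_inr (Fin.append _ _ ∘ _)]
  refine LinearIndependent.sum_type ?_ ?_ ?_
  · convert a.linearIndependent.map' P.subtype P.ker_subtype
    ext i
    simp
  · convert b.linearIndependent.map' Q.subtype Q.ker_subtype
    ext i
    simp
  · refine hPQ.mono ?_ ?_ <;> rw [Submodule.span_le] <;> rintro _ ⟨i, rfl⟩ <;> simp

lemma mul_mul_ne_zero_of_sup_eq_top {P Q R : Submodule K V} (hPQR : P ⊔ Q ⊔ R = ⊤) {l m n : ℕ}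
    (hlmn : finrank K V = l + m + n)
    (hP : finrank K P = l) (hQ : finrank K Q = m) (hR : finrank K R = n)
    {x y z : ExteriorAlgebra K V}
    (hx : x ∈ (P.map (ExteriorAlgebra.ι K)) ^ l) (hx0 : x ≠ 0)
    (hy : y ∈ (Q.map (ExteriorAlgebra.ι K)) ^ m) (hy0 : y ≠ 0)
    (hz : z ∈ (R.map (ExteriorAlgebra.ι K)) ^ n) (hz0 : z ≠ 0) : x * y * z ≠ 0 := by
  have h1 := Submodule.finrank_sup_add_finrank_inf_eq P Q
  have h2 := Submodule.finrank_sup_add_finrank_inf_eq (P ⊔ Q) R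
  rw [hPQR, finrank_top] at h2
  have hdPQ : Disjoint P Q := by
    rw [disjoint_iff, ← Submodule.finrank_eq_zero (R := K)]; omega
  have hdR : Disjoint (P ⊔ Q) R := by
    rw [disjoint_iff, ← Submodule.finrank_eq_zero (R := K)]; omega
  refine mul_ne_zero_of_disjoint hdR (m := l + m) (by omega) hR ?_
    (mul_ne_zero_of_disjoint hdPQ hP hQ hx hx0 hy hy0) hz hz0
  rw [pow_add]
  exact Submodule.mul_mem_mul
    (pow_le_pow_left' (Submodule.map_mono le_sup_left) l hx)
    (pow_le_pow_left' (Submodule.map_mono le_sup_right) m hy)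

end ExteriorPowers

section FlagElements

variable {d : ℕ}

lemma flagElt_mem_and_ne_zero (F : CompleteFlag d) {k : ℕ} (hk : k ≤ d) :
    flagElt F k ∈ flagPower F k ∧ flagElt F k ≠ 0 := by
  have h : ∃ x, x ∈ flagPower F k ∧ x ≠ 0 := by
    refine (Submodule.ne_bot_iff _).1 fun hbot => ?_
    have h1 := finrank_map_ι_pow (F.space k) k
    rw [F.finrank_eq k hk, Nat.choose_self, ← flagPower, hbot, finrank_bot] at h1
    exact one_ne_zero h1.symm
  rw [flagElt, dif_pos h]
  exact h.choose_spec

lemma exists_eq_smul_flagElt (F : CompleteFlag d) {k : ℕ} (hk : k ≤ d) {x : ExtAlg d}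
    (hx : x ∈ flagPower F k) : ∃ r : ℂ, x = r • flagElt F k :=
  exists_eq_smul_of_mem_map_ι_pow (F.finrank_eq k hk) (flagElt_mem_and_ne_zero F hk).1
    (flagElt_mem_and_ne_zero F hk).2 hx

lemma ι_mul_flagElt (F : CompleteFlag d) {k : ℕ} (hk : k ≤ d) (v : Fin d → ℂ) :
    ExteriorAlgebra.ι ℂ v * flagElt F k =
      (-1 : ℂ) ^ k • (flagElt F k * ExteriorAlgebra.ι ℂ v) :=
  ι_mul_eq_neg_one_pow_smul
    (map_ι_pow_le_range_pow _ _ (flagElt_mem_and_ne_zero F hk).1) v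

lemma flagElt_mul_ι_eq_zero (F : CompleteFlag d) {k : ℕ} (hk : k ≤ d) {v : Fin d → ℂ}
    (hv : v ∈ F.space k) : flagElt F k * ExteriorAlgebra.ι ℂ v = 0 :=
  mul_ι_eq_zero_of_mem (F.finrank_eq k hk) (flagElt_mem_and_ne_zero F hk).1 hv

lemma exists_flagElt_mul_ι_eq_smul (F : CompleteFlag d) {k : ℕ} (hk : k + 1 ≤ d)
    {v : Fin d → ℂ} (hv : v ∈ F.space (k + 1)) :
    ∃ r : ℂ, flagElt F k * ExteriorAlgebra.ι ℂ v = r • flagElt F (k + 1) := by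
  refine exists_eq_smul_flagElt F hk ?_
  rw [flagPower, pow_succ]
  refine Submodule.mul_mem_mul ?_ (Submodule.mem_map_of_mem hv)
  exact pow_le_pow_left' (Submodule.map_mono (F.mono k.le_succ)) k
    (flagElt_mem_and_ne_zero F (by omega)).1

lemma exists_flagElt_zero_eq_smul_one (F : CompleteFlag d) :
    ∃ r : ℂ, r ≠ 0 ∧ flagElt F 0 = r • 1 := by
  obtain ⟨h1, h2⟩ := flagElt_mem_and_ne_zero F (Nat.zero_le d)
  rw [flagPower, pow_zero, Submodule.mem_one] at h1
  obtain ⟨r, hr⟩ := h1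
  rw [Algebra.algebraMap_eq_smul_one] at hr
  refine ⟨r, ?_, hr.symm⟩
  rintro rfl
  exact h2 (by rw [← hr, zero_smul])

lemma exists_ι_eq_smul_flagElt_one (F : CompleteFlag d) (hd : 1 ≤ d) {v : Fin d → ℂ}
    (hv : v ∈ F.space 1) (hv0 : v ≠ 0) :
    ∃ r : ℂ, r ≠ 0 ∧ ExteriorAlgebra.ι ℂ v = r • flagElt F 1 := by
  obtain ⟨r, hr⟩ := exists_eq_smul_flagElt F hd (x := ExteriorAlgebra.ι ℂ v)
    (by rw [flagPower, pow_one]; exact Submodule.mem_map_of_mem hv)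
  refine ⟨r, ?_, hr⟩
  rintro rfl
  rw [zero_smul, ExteriorAlgebra.ι_eq_zero_iff] at hr
  exact hv0 hr

lemma flagElt_mul_flagElt_mul_ι_eq_zero (F G : CompleteFlag d) {i j : ℕ} (hi : i ≤ d) (hj : j ≤ d)
    {w : Fin d → ℂ} (hw : w ∈ F.space i ⊔ G.space j) :
    flagElt F i * flagElt G j * ExteriorAlgebra.ι ℂ w = 0 := by
  obtain ⟨p, hp, q, hq, rfl⟩ := Submodule.mem_sup.1 hw
  have h := ι_mul_flagElt G hj p
  have h' : flagElt G j * ExteriorAlgebra.ι ℂ p =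
      (-1 : ℂ) ^ j • (ExteriorAlgebra.ι ℂ p * flagElt G j) := by
    rw [h, smul_smul, ← mul_pow]; simp
  rw [map_add, mul_add, mul_assoc, mul_assoc, flagElt_mul_ι_eq_zero G hj hq, h', mul_smul_comm,
    ← mul_assoc, flagElt_mul_ι_eq_zero F hi hp]
  simp

lemma ι_mul_flagElt_mul_flagElt_eq_zero (F G : CompleteFlag d) {i j : ℕ} (hi : i ≤ d) (hj : j ≤ d)
    {w : Fin d → ℂ} (hw : w ∈ F.space i ⊔ G.space j) :
    ExteriorAlgebra.ι ℂ w * flagElt F i * flagElt G j = 0 := by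
  rw [ι_mul_flagElt F hi, smul_mul_assoc, mul_assoc, ι_mul_flagElt G hj, mul_smul_comm,
    ← mul_assoc, flagElt_mul_flagElt_mul_ι_eq_zero F G hi hj hw]
  simp

/-- The scalar `f₁^x ∧ f₂^y ∧ f₃^z` for the canonical choices of elements. -/
noncomputable def flagBracket (φ : ExtAlg d →ₗ[ℂ] ℂ) (F₁ F₂ F₃ : CompleteFlag d)
    (x y z : ℕ) : ℂ :=
  φ (flagElt F₁ x * flagElt F₂ y * flagElt F₃ z)

lemma flagBracket_ne_zero {φ : ExtAlg d →ₗ[ℂ] ℂ} (hφ : IsTopIso φ) {F₁ F₂ F₃ : CompleteFlag d}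
    (hF : GenPos ![F₁, F₂, F₃]) {x y z : ℕ} (hxyz : x + y + z = d) :
    flagBracket φ F₁ F₂ F₃ x y z ≠ 0 := by
  obtain ⟨h1, h1'⟩ := flagElt_mem_and_ne_zero F₁ (k := x) (by omega)
  obtain ⟨h2, h2'⟩ := flagElt_mem_and_ne_zero F₂ (k := y) (by omega)
  obtain ⟨h3, h3'⟩ := flagElt_mem_and_ne_zero F₃ (k := z) (by omega)
  have htop : F₁.space x ⊔ F₂.space y ⊔ F₃.space z = ⊤ := by
    have h := hF ![x, y, z] (by simpa [Fin.sum_univ_three] using hxyz)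
    rw [eq_top_iff, ← h]
    refine iSup_le fun i => ?_
    fin_cases i
    · exact le_sup_of_le_left le_sup_left
    · exact le_sup_of_le_left le_sup_right
    · exact le_sup_right
  have hne := mul_mul_ne_zero_of_sup_eq_top htop (by simp [hxyz]) (F₁.finrank_eq x (by omega))
    (F₂.finrank_eq y (by omega)) (F₃.finrank_eq z (by omega)) h1 h1' h2 h2' h3 h3'
  refine fun h0 => hne (hφ _ ?_ h0)
  have hmem := Submodule.mul_mem_mul (Submodule.mul_mem_mul (map_ι_pow_le_range_pow _ _ h1)
    (map_ι_pow_le_range_pow _ _ h2)) (map_ι_pow_le_range_pow _ _ h3)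
  rwa [← pow_add, ← pow_add, hxyz] at hmem

lemma sum_sub_mem_sup_of_adaptedBasis {F G H : CompleteFlag d} {v : ℕ → (Fin d → ℂ)}
    (hv : AdaptedBasis F G H v) {i j : ℕ} (hij : i + 1 + j = d) :
    (∑ m ∈ Finset.Icc 1 d, v m) - v (i + 1) ∈ F.space i ⊔ H.space j := by
  rw [← Finset.add_sum_erase _ v (Finset.mem_Icc.2 ⟨by omega, by omega⟩ : i + 1 ∈ Finset.Icc 1 d),
    add_sub_cancel_left]
  refine Submodule.sum_mem _ fun k hk => ?_
  rw [Finset.mem_erase, Finset.mem_Icc] at hk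
  obtain ⟨hF, hH⟩ := hv.2.1 k hk.2.1 hk.2.2
  by_cases hki : k ≤ i
  · exact Submodule.mem_sup_left (F.mono hki hF)
  · exact Submodule.mem_sup_right (H.mono (by omega) hH)

lemma IsBasisFam.ne_zero {v : ℕ → (Fin d → ℂ)} (hv : IsBasisFam d v) {m : ℕ} (h1 : 1 ≤ m)
    (hm : m ≤ d) : v m ≠ 0 := by
  have h := hv.1.ne_zero ⟨m - 1, by omega⟩
  rwa [show ((⟨m - 1, by omega⟩ : Fin d) : ℕ) + 1 = m from Nat.sub_add_cancel h1] at h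

lemma IsBasisFam.sum_ne_zero {v : ℕ → (Fin d → ℂ)} (hv : IsBasisFam d v) (hd : 1 ≤ d) :
    ∑ m ∈ Finset.Icc 1 d, v m ≠ 0 := by
  intro h
  have h' : ∑ i : Fin d, (1 : ℂ) • v ((i : ℕ) + 1) = 0 := by
    simp only [one_smul]
    rw [Fin.sum_univ_eq_sum_range (fun i => v (i + 1)), Finset.range_eq_Ico,
      Finset.sum_Ico_add' v 0 d 1]
    exact h
  exact one_ne_zero (Fintype.linearIndependent_iff.1 hv.1 _ h' ⟨0, hd⟩)

lemma flagBracket_mul_of_adaptedBasis (φ : ExtAlg d →ₗ[ℂ] ℂ) (F₁ F₂ F₃ : CompleteFlag d)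
    {f : ℕ → (Fin d → ℂ)} (hf : AdaptedBasis F₂ F₃ F₁ f) (hd : 1 ≤ d) :
    ∃ κ : ℂ, κ ≠ 0 ∧ ∀ i n : ℕ, i + 1 + n = d → ∀ α : ℂ,
      flagElt F₂ i * ExteriorAlgebra.ι ℂ (f (i + 1)) = α • flagElt F₂ (i + 1) →
      α * flagBracket φ F₁ F₂ F₃ n (i + 1) 0 = κ * flagBracket φ F₁ F₂ F₃ n i 1 := by
  obtain ⟨σ, hσ, hs⟩ := exists_ι_eq_smul_flagElt_one F₃ hd hf.2.2 (hf.1.sum_ne_zero hd)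
  obtain ⟨γ, hγ, hc⟩ := exists_flagElt_zero_eq_smul_one F₃
  refine ⟨γ * σ, mul_ne_zero hγ hσ, fun i n hin α hα => ?_⟩
  have hw := sum_sub_mem_sup_of_adaptedBasis hf hin
  rw [sup_comm] at hw
  have h := flagElt_mul_flagElt_mul_ι_eq_zero F₁ F₂ (by omega) (by omega) hw
  rw [map_sub, mul_sub, sub_eq_zero, hs, mul_assoc _ _ (ExteriorAlgebra.ι ℂ _), hα] at h
  have h' := congrArg φ h
  simp only [mul_smul_comm, map_smul, smul_eq_mul] at h'
  simp only [flagBracket, hc, mul_smul_comm, map_smul, smul_eq_mul, mul_one]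
  linear_combination -γ * h'

lemma flagBracket_mul_of_adaptedBasis' (φ : ExtAlg d →ₗ[ℂ] ℂ) (F₁ F₂ F₃ : CompleteFlag d)
    {f' : ℕ → (Fin d → ℂ)} (hf' : AdaptedBasis F₃ F₁ F₂ f') (hd : 1 ≤ d) :
    ∃ κ : ℂ, κ ≠ 0 ∧ ∀ i n : ℕ, i + 1 + n = d → ∀ α : ℂ,
      flagElt F₂ i * ExteriorAlgebra.ι ℂ (f' (n + 1)) = α • flagElt F₂ (i + 1) →
      (-1) ^ i * α * flagBracket φ F₁ F₂ F₃ 0 (i + 1) n =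
        κ * flagBracket φ F₁ F₂ F₃ 1 i n := by
  obtain ⟨σ, hσ, hs⟩ := exists_ι_eq_smul_flagElt_one F₁ hd hf'.2.2 (hf'.1.sum_ne_zero hd)
  obtain ⟨γ, hγ, hc⟩ := exists_flagElt_zero_eq_smul_one F₁
  refine ⟨γ * σ, mul_ne_zero hγ hσ, fun i n hin α hα => ?_⟩
  have hw := sum_sub_mem_sup_of_adaptedBasis hf' (i := n) (j := i) (by omega)
  rw [sup_comm] at hw
  have h := ι_mul_flagElt_mul_flagElt_eq_zero F₂ F₃ (by omega) (by omega) hw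
  rw [map_sub, sub_mul, sub_mul, sub_eq_zero, hs, ι_mul_flagElt F₂ (by omega), hα] at h
  have h' := congrArg φ h
  simp only [smul_mul_assoc, map_smul, smul_eq_mul] at h'
  simp only [flagBracket, hc, smul_mul_assoc, map_smul, smul_eq_mul, one_mul]
  linear_combination -γ * h'

end FlagElements

section TripleRatioProducts

variable {d : ℕ} {φ : ExtAlg d →ₗ[ℂ] ℂ} {F₁ F₂ F₃ : CompleteFlag d}

lemma tripleRatio_eq_flagBracket (x y z : ℕ) :
    tripleRatio φ F₁ F₂ F₃ (x + 1, y + 1, z + 1) =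
      (flagBracket φ F₁ F₂ F₃ (x + 2) (y + 1) z * flagBracket φ F₁ F₂ F₃ (x + 1) y (z + 2) *
        flagBracket φ F₁ F₂ F₃ x (y + 2) (z + 1)) /
      (flagBracket φ F₁ F₂ F₃ x (y + 1) (z + 2) * flagBracket φ F₁ F₂ F₃ (x + 1) (y + 2) z *
        flagBracket φ F₁ F₂ F₃ (x + 2) y (z + 1)) :=
  rfl

/-- Telescoping of the triple ratios along a row `j₂ = i + 1`. -/
lemma prod_range_tripleRatio
    (hD : ∀ x y z, x + y + z = d → flagBracket φ F₁ F₂ F₃ x y z ≠ 0) {i n : ℕ}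
    (hin : i + 2 + n = d) (N : ℕ) (hN : N ≤ n) :
    ∏ r ∈ Finset.range N, tripleRatio φ F₁ F₂ F₃ (r + 1, i + 1, n - r) =
      (flagBracket φ F₁ F₂ F₃ (N + 1) (i + 1) (n - N) *
        flagBracket φ F₁ F₂ F₃ N (i + 1) (n + 1 - N) *
        flagBracket φ F₁ F₂ F₃ 1 i (n + 1) * flagBracket φ F₁ F₂ F₃ 0 (i + 2) n) /
      (flagBracket φ F₁ F₂ F₃ 1 (i + 1) n * flagBracket φ F₁ F₂ F₃ 0 (i + 1) (n + 1) *
        flagBracket φ F₁ F₂ F₃ (N + 1) i (n + 1 - N) *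
        flagBracket φ F₁ F₂ F₃ N (i + 2) (n - N)) := by
  induction N with
  | zero =>
    have h1 := hD 1 (i + 1) n (by omega)
    have h2 := hD 0 (i + 1) (n + 1) (by omega)
    have h3 := hD 1 i (n + 1) (by omega)
    have h4 := hD 0 (i + 2) n (by omega)
    simp only [Finset.range_zero, Finset.prod_empty, Nat.sub_zero, zero_add]
    field_simp
  | succ N ih =>
    obtain ⟨z, rfl⟩ : ∃ z, n = N + z + 1 := ⟨n - N - 1, by omega⟩
    rw [Finset.prod_range_succ, ih (by omega), show N + z + 1 - N = z + 1 by omega,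
      show N + z + 1 + 1 - N = z + 2 by omega, show N + z + 1 - (N + 1) = z by omega,
      show N + z + 1 + 1 - (N + 1) = z + 1 by omega, tripleRatio_eq_flagBracket]
    have h1 := hD 1 (i + 1) (N + z + 1) (by omega)
    have h2 := hD 0 (i + 1) (N + z + 1 + 1) (by omega)
    have h3 := hD (N + 1) i (z + 2) (by omega)
    have h4 := hD N (i + 2) (z + 1) (by omega)
    have h5 := hD (N + 1) (i + 2) z (by omega)
    have h6 := hD (N + 2) i (z + 1) (by omega)
    have h7 := hD N (i + 1) (z + 2) (by omega)
    rw [div_mul_div_comm, div_eq_div_iff (by positivity) (by positivity)]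
    ring

lemma prod_filter_Bset_succ (T : ℕ × ℕ × ℕ → ℂ) {i n : ℕ} (hin : i + 2 + n = d) :
    ∏ j ∈ (Bset d).filter (fun j => j.2.1 ≤ i + 1), T j =
      (∏ j ∈ (Bset d).filter (fun j => j.2.1 ≤ i), T j) *
        ∏ r ∈ Finset.range n, T (r + 1, i + 1, n - r) := by
  have hrow : ∏ j ∈ (Bset d).filter (fun j => j.2.1 = i + 1), T j =
      ∏ r ∈ Finset.range n, T (r + 1, i + 1, n - r) := by
    symm
    refine Finset.prod_bij (fun r _ => (r + 1, i + 1, n - r)) ?_ ?_ ?_ fun _ _ => rfl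
    · intro r hr
      simp only [Finset.mem_range] at hr
      simp only [Bset, Finset.mem_filter, Finset.mem_product, Finset.mem_range, and_true]
      omega
    · intro r _ s _ h
      simpa using congrArg Prod.fst h
    · rintro ⟨x, y, z⟩ h
      simp only [Bset, Finset.mem_filter, Finset.mem_product, Finset.mem_range] at h
      refine ⟨x - 1, Finset.mem_range.2 (by omega), ?_⟩
      simp only [Prod.mk.injEq]
      omega
  rw [← hrow, ← Finset.prod_union]
  · congr 1
    ext j
    simp only [Finset.mem_union, Finset.mem_filter]
    grind
  · rw [Finset.disjoint_filter]
    intro j _ _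
    omega

lemma eq_prod_tripleRatio_of_flagBracket_mul
    (hD : ∀ x y z, x + y + z = d → flagBracket φ F₁ F₂ F₃ x y z ≠ 0)
    {c : ℕ → ℂ} (hc : c 0 = 1) {κ κ' : ℂ} (hκ' : κ' ≠ 0)
    (h : ∀ i n, i + 1 + n = d →
      κ' * c i * flagBracket φ F₁ F₂ F₃ 1 i n * flagBracket φ F₁ F₂ F₃ n (i + 1) 0 =
        (-1) ^ i * κ * flagBracket φ F₁ F₂ F₃ n i 1 * flagBracket φ F₁ F₂ F₃ 0 (i + 1) n)
    (i : ℕ) (hi : i + 1 ≤ d) :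
    c i = (-1) ^ i * ∏ j ∈ (Bset d).filter (fun j => j.2.1 ≤ i), tripleRatio φ F₁ F₂ F₃ j := by
  induction i with
  | zero =>
    rw [Finset.filter_eq_empty_iff.2, hc]
    · simp
    · intro j hj
      simp only [Bset, Finset.mem_filter] at hj
      omega
  | succ i ih =>
    obtain ⟨n, hn⟩ : ∃ n, i + 2 + n = d := ⟨d - (i + 2), by omega⟩
    rw [prod_filter_Bset_succ _ hn, ← mul_assoc, pow_succ, mul_right_comm _ (-1 : ℂ), ← ih (by omega),
      prod_range_tripleRatio hD hn n le_rfl, Nat.sub_self, show n + 1 - n = 1 by omega]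
    have e1 := h i (n + 1) (by omega)
    have e2 := h (i + 1) n (by omega)
    have h1 := hD 1 (i + 1) n (by omega)
    have h2 := hD 0 (i + 1) (n + 1) (by omega)
    have h3 := hD (n + 1) i 1 (by omega)
    have h4 := hD n (i + 2) 0 (by omega)
    rw [← mul_div_assoc, eq_div_iff (by simp [h1, h2, h3, h4])]
    refine mul_left_cancel₀ hκ' ?_
    linear_combination flagBracket φ F₁ F₂ F₃ 0 (i + 1) (n + 1) *
        flagBracket φ F₁ F₂ F₃ (n + 1) i 1 * e2 +
      flagBracket φ F₁ F₂ F₃ n (i + 1) 1 * flagBracket φ F₁ F₂ F₃ 0 (i + 2) n * e1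

end TripleRatioProducts

section UnipotentFlags

variable {d : ℕ}

/-- A unipotent map preserving a complete flag acts trivially on its graded pieces. -/
lemma sub_mem_of_isNilpotent_sub_one (F : CompleteFlag d) {u : Module.End ℂ (Fin d → ℂ)}
    (hu : IsNilpotent (u - 1)) (huF : ∀ k, Submodule.map u (F.space k) = F.space k)
    {k : ℕ} (hk : k + 1 ≤ d) {x : Fin d → ℂ} (hx : x ∈ F.space (k + 1)) :
    u x - x ∈ F.space k := by
  have hN : ∀ k, ∀ y ∈ F.space k, (u - 1) y ∈ F.space k := fun k y hy =>
    Submodule.sub_mem _ (huF k ▸ Submodule.mem_map_of_mem hy) hy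
  change (u - 1) x ∈ F.space k
  by_cases hxk : x ∈ F.space k
  · exact hN k x hxk
  have hlt : F.space k < F.space k ⊔ ℂ ∙ x := by
    refine lt_of_le_of_ne le_sup_left fun h => hxk ?_
    rw [h]
    exact Submodule.mem_sup_right (Submodule.mem_span_singleton_self x)
  have hle : F.space k ⊔ ℂ ∙ x ≤ F.space (k + 1) :=
    sup_le (F.mono k.le_succ) (by simpa using hx)
  have hfin := Submodule.finrank_lt_finrank_of_lt hlt
  rw [F.finrank_eq k (by omega)] at hfin
  have heq : F.space k ⊔ ℂ ∙ x = F.space (k + 1) :=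
    Submodule.eq_of_le_of_finrank_le hle (by rw [F.finrank_eq _ hk]; omega)
  obtain ⟨y, hy, z, hz, hyz⟩ := Submodule.mem_sup.1 (heq ▸ hN _ x hx)
  obtain ⟨r, rfl⟩ := Submodule.mem_span_singleton.1 hz
  have hpow : ∀ n : ℕ, ((u - 1) ^ n) x - r ^ n • x ∈ F.space k := by
    intro n
    induction n with
    | zero => simp
    | succ n ih =>
      have h1 := Submodule.add_mem _ (hN k _ ih) (Submodule.smul_mem _ (r ^ n) hy)
      have h2 : y = (u - 1) x - r • x := eq_sub_of_add_eq hyz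
      rw [map_sub, map_smul, h2, smul_sub, smul_smul, ← pow_succ] at h1
      rw [pow_succ' (u - 1), Module.End.mul_apply]
      simpa using h1
  obtain ⟨n, hn⟩ := hu
  have h := hpow n
  rw [hn, LinearMap.zero_apply, zero_sub, Submodule.neg_mem_iff] at h
  have hr : r = 0 := by
    by_contra hr
    exact hxk ((Submodule.smul_mem_iff _ (pow_ne_zero n hr)).1 h)
  rw [← hyz, hr, zero_smul, add_zero]
  exact hy

lemma exists_eq_smul_of_mem_inf {F G : CompleteFlag d} {i n : ℕ} (hin : i + 1 + n = d)
    (hFG : F.space (i + 1) ⊔ G.space n = ⊤) {v w : Fin d → ℂ}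
    (hv : v ∈ F.space (i + 1) ⊓ G.space (n + 1)) (hv0 : v ≠ 0)
    (hw : w ∈ F.space (i + 1) ⊓ G.space (n + 1)) : ∃ r : ℂ, w = r • v := by
  have htop : F.space (i + 1) ⊔ G.space (n + 1) = ⊤ :=
    top_le_iff.1 (hFG ▸ sup_le_sup_left (G.mono n.le_succ) _)
  have h := Submodule.finrank_sup_add_finrank_inf_eq (F.space (i + 1)) (G.space (n + 1))
  rw [htop, finrank_top, Module.finrank_fin_fun, F.finrank_eq _ (by omega),
    G.finrank_eq _ (by omega)] at h
  have h1 : Module.finrank ℂ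
      (F.space (i + 1) ⊓ G.space (n + 1) : Submodule ℂ (Fin d → ℂ)) = 1 := by omega
  obtain ⟨r, hr⟩ := (finrank_eq_one_iff_of_nonzero' (⟨v, hv⟩ :
    (F.space (i + 1) ⊓ G.space (n + 1) : Submodule ℂ (Fin d → ℂ))) (by simpa using hv0)).1
    h1 ⟨w, hw⟩
  exact ⟨r, (congrArg Subtype.val hr).symm⟩

lemma CompleteFlag.space_zero (F : CompleteFlag d) : F.space 0 = ⊥ :=
  Submodule.finrank_eq_zero.1 (F.finrank_eq 0 (Nat.zero_le d))

lemma GenPos.sup_eq_top {F₁ F₂ F₃ : CompleteFlag d} (hF : GenPos ![F₁, F₂, F₃]) {y z : ℕ}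
    (hyz : y + z = d) : F₂.space y ⊔ F₃.space z = ⊤ := by
  have h := hF ![0, y, z] (by simpa [Fin.sum_univ_three] using hyz)
  rw [eq_top_iff, ← h]
  refine iSup_le fun i => ?_
  fin_cases i
  · simp [F₁.space_zero]
  · exact le_sup_left
  · exact le_sup_right

end UnipotentFlags

/-- Proposition 5.1: if `u ∈ SL_d(ℂ)` is the unipotent map fixing `F₂` and
sending `F₁` to `F₃`, and `f`, `f'` are bases adapted to `(F₂,F₃,F₁)` and `(F₃,F₁,F₂)` with
`f₁ = f'_d`, then `u f_m = (-1)^{m-1} (∏_{j ∈ ℬ, j₂ ≤ m-1} T^j(F₁,F₂,F₃)) f'_{d-m+1}`. -/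
theorem unipotent_on_adapted_basis
    (d : ℕ) (hd : 2 ≤ d) (φ : ExtAlg d →ₗ[ℂ] ℂ) (hφ : IsTopIso φ)
    (F₁ F₂ F₃ : CompleteFlag d) (hF : GenPos ![F₁, F₂, F₃])
    (u : Module.End ℂ (Fin d → ℂ)) (hu : IsNilpotent (u - 1)) (hdet : LinearMap.det u = 1)
    (hu₂ : ∀ k, Submodule.map u (F₂.space k) = F₂.space k)
    (hu₁₃ : ∀ k, Submodule.map u (F₁.space k) = F₃.space k)
    (f f' : ℕ → (Fin d → ℂ))
    (hf : AdaptedBasis F₂ F₃ F₁ f) (hf' : AdaptedBasis F₃ F₁ F₂ f')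
    (hff' : f 1 = f' d) :
    ∀ m, 1 ≤ m → m ≤ d →
      u (f m) =
        ((-1 : ℂ) ^ (m - 1) *
            ∏ j ∈ (Bset d).filter (fun j => j.2.1 ≤ m - 1), tripleRatio φ F₁ F₂ F₃ j) •
          f' (d - m + 1) := by
  have hD : ∀ x y z, x + y + z = d → flagBracket φ F₁ F₂ F₃ x y z ≠ 0 :=
    fun x y z h => flagBracket_ne_zero hφ hF h
  obtain ⟨κ, -, hκ⟩ := flagBracket_mul_of_adaptedBasis φ F₁ F₂ F₃ hf (by omega)
  obtain ⟨κ', hκ'0, hκ'⟩ := flagBracket_mul_of_adaptedBasis' φ F₁ F₂ F₃ hf' (by omega)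
  have hmul : ∀ i, i + 1 ≤ d → ∃ c : ℂ, u (f (i + 1)) = c • f' (d - i) := by
    intro i hi
    have hin : i + 1 + (d - (i + 1)) = d := by omega
    obtain ⟨h1, h2⟩ := hf.2.1 (i + 1) (by omega) hi
    obtain ⟨h3, h4⟩ := hf'.2.1 (d - i) (by omega) (by omega)
    rw [show d - (d - i) + 1 = i + 1 by omega] at h4
    rw [show d - i = d - (i + 1) + 1 by omega] at h3 h4 ⊢
    exact exists_eq_smul_of_mem_inf hin (hF.sup_eq_top hin) ⟨h4, h3⟩
      (hf'.1.ne_zero (by omega) (by omega))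
      ⟨hu₂ (i + 1) ▸ Submodule.mem_map_of_mem h1, hu₁₃ _ ▸ Submodule.mem_map_of_mem h2⟩
  choose! c hc using hmul
  have hc0 : c 0 = 1 := by
    have h1 := sub_mem_of_isNilpotent_sub_one F₂ hu hu₂ (k := 0) (by omega)
      (hf.2.1 1 le_rfl (by omega)).1
    rw [F₂.space_zero, Submodule.mem_bot, hc 0 (by omega), Nat.sub_zero, hff'] at h1
    have h2 : (c 0 - 1) • f' d = 0 := by rw [sub_smul, one_smul]; exact h1
    exact sub_eq_zero.1 ((smul_eq_zero.1 h2).resolve_right (hf'.1.ne_zero (by omega) le_rfl))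
  have hrel : ∀ i n, i + 1 + n = d →
      κ' * c i * flagBracket φ F₁ F₂ F₃ 1 i n * flagBracket φ F₁ F₂ F₃ n (i + 1) 0 =
        (-1) ^ i * κ * flagBracket φ F₁ F₂ F₃ n i 1 * flagBracket φ F₁ F₂ F₃ 0 (i + 1) n := by
    intro i n hin
    have hfi := (hf.2.1 (i + 1) (by omega) (by omega)).1
    have hfi' := (hf'.2.1 (n + 1) (by omega) (by omega)).2
    rw [show d - (n + 1) + 1 = i + 1 by omega] at hfi'
    have hu' := sub_mem_of_isNilpotent_sub_one F₂ hu hu₂ (by omega) hfi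
    rw [hc i (by omega), show d - i = n + 1 by omega] at hu'
    obtain ⟨α', hα'⟩ := exists_flagElt_mul_ι_eq_smul F₂ (by omega) hfi'
    have hα : flagElt F₂ i * ExteriorAlgebra.ι ℂ (f (i + 1)) =
        (c i * α') • flagElt F₂ (i + 1) := by
      have h := flagElt_mul_ι_eq_zero F₂ (by omega) hu'
      rw [map_sub, map_smul, mul_sub, mul_smul_comm, hα', sub_eq_zero, smul_smul] at h
      exact h.symm
    have e1 := hκ i n hin _ hα
    have e2 := hκ' i n hin _ hα'
    linear_combination (-1) ^ i * flagBracket φ F₁ F₂ F₃ 0 (i + 1) n * e1 -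
      c i * flagBracket φ F₁ F₂ F₃ n (i + 1) 0 * e2
  intro m h1 hm
  obtain ⟨i, rfl⟩ : ∃ i, m = i + 1 := ⟨m - 1, by omega⟩
  rw [Nat.add_sub_cancel, ← eq_prod_tripleRatio_of_flagBracket_mul hD hc0 hκ'0 hrel i hm, hc i hm,
    show d - (i + 1) + 1 = d - i by omega]
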